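/- t is reachable from s by a directed path in G if and only if there is a set D of at most k vertices of G′ such that in the induced subgraph G′ ∖ D every vertex has an out-neighbor, that is, for every vertex x of G′ ∖ D there is a vertex y of G′ ∖ D with a directed edge (x, y) (where y = x via a self-loop is allowed). -/

import Mathlib

/-- A directed graph on `Fin n × Fin k` (layer `i+1`, 1-based, is `Fin n × {i}`) is a
*matched layered graph* if every edge goes from a layer to the next one, every vertex
outside the last layer has exactly one out-neighbor, and every vertex outside the
first layer has exactly one in-neighbor. -/
def MatchedLayered {n k : ℕ} (E : Fin n × Fin k → Fin n × Fin k → Prop) : Prop :=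
  (∀ v w, E v w → (w.2 : ℕ) = (v.2 : ℕ) + 1) ∧
    (∀ v, (v.2 : ℕ) + 1 < k → ∃! w, E v w) ∧
    (∀ w, 0 < (w.2 : ℕ) → ∃! v, E v w)

/-- The vertex set of `G′`: the original vertices, plus a new vertex `u⁻` for every
beginning `u = (a, s.2)` of a path with `u ≠ s`. -/
def Vert (n k : ℕ) (s : Fin n × Fin k) : Type :=
  (Fin n × Fin k) ⊕ {a : Fin n // a ≠ s.1}

/-- The directed edges of `G′` (self-loops allowed): the edges of `G`; a self-loop
`(v, v)` for every `v = (a, t.2)` in the last layer with `v ≠ t`; and the edge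
`(u⁻, u)` for every first-layer vertex `u = (a, s.2)` with `u ≠ s`. -/
inductive GRel {n k : ℕ} (E : Fin n × Fin k → Fin n × Fin k → Prop) (s t : Fin n × Fin k) :
    Vert n k s → Vert n k s → Prop
  | base {v w} : E v w → GRel E s t (Sum.inl v) (Sum.inl w)
  | loop (a : Fin n) : a ≠ t.1 →
      GRel E s t (Sum.inl (a, t.2)) (Sum.inl (a, t.2))
  | pre (a : {a : Fin n // a ≠ s.1}) :
      GRel E s t (Sum.inr a) (Sum.inl (a.1, s.2))

theorem reach_le {n k : ℕ} {E : Fin n × Fin k → Fin n × Fin k → Prop}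
    (hE : MatchedLayered E) {u t : Fin n × Fin k} (h : Relation.ReflTransGen E u t) :
    (u.2 : ℕ) ≤ t.2 := by
  induction h with
  | refl => exact le_rfl
  | tail _ h2 ih => have := hE.1 _ _ h2; omega

theorem reach_inj {n k : ℕ} {E : Fin n × Fin k → Fin n × Fin k → Prop}
    (hE : MatchedLayered E) {u t : Fin n × Fin k} (h : Relation.ReflTransGen E u t) :
    ∀ v, Relation.ReflTransGen E v t → (v.2 : ℕ) = u.2 → v = u := by
  induction h using Relation.ReflTransGen.head_induction_on with
  | refl =>
    intro v hv e
    rcases hv.cases_head with h | ⟨w, h1, h2⟩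
    · exact h
    · have := hE.1 _ _ h1
      have := reach_le hE h2
      omega
  | head h1 h2 ih =>
    intro v hv e
    have e1 := hE.1 _ _ h1
    have l1 := reach_le hE h2
    rcases hv.cases_head with h | ⟨w', h3, h4⟩
    · subst h; omega
    · have e2 := hE.1 _ _ h3
      have := ih w' h4 (by omega)
      subst this
      exact (hE.2.2 w' (by omega)).unique h3 h1

theorem reach_ex {n k : ℕ} {E : Fin n × Fin k → Fin n × Fin k → Prop}
    (hE : MatchedLayered E) {t : Fin n × Fin k} (ht : (t.2 : ℕ) + 1 = k) (d : ℕ) :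
    ∀ j, j + d + 1 = k → ∃ v : Fin n × Fin k, (v.2 : ℕ) = j ∧ Relation.ReflTransGen E v t := by
  induction d with
  | zero => exact fun j hj => ⟨t, by omega, .refl⟩
  | succ d ih =>
    intro j hj
    obtain ⟨w, hw, hr⟩ := ih (j + 1) (by omega)
    obtain ⟨v, hv, -⟩ := hE.2.2 w (by omega)
    have := hE.1 _ _ hv
    exact ⟨v, by omega, hr.head hv⟩

instance vertFinite (n k : ℕ) (s : Fin n × Fin k) : Finite (Vert n k s) := by
  unfold Vert; infer_instance

/-- `t` is reachable from `s` in the matched layered graph `G` if and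
only if at most `k` vertices can be deleted from `G′` so that in the remaining induced
directed subgraph every vertex has an out-neighbor (possibly itself, via a
self-loop). -/
theorem stmt_14 {n k : ℕ} (E : Fin n × Fin k → Fin n × Fin k → Prop)
    (hE : MatchedLayered E) (s t : Fin n × Fin k)
    (hs : (s.2 : ℕ) = 0) (ht : (t.2 : ℕ) + 1 = k) :
    Relation.ReflTransGen E s t ↔
      ∃ D : Set (Vert n k s), D.ncard ≤ k ∧
        ∀ x : Vert n k s, x ∉ D → ∃ y : Vert n k s, y ∉ D ∧ GRel E s t x y := by
  constructor
  · intro hst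
    refine ⟨(fun v => (Sum.inl v : Vert n k s)) '' {v | Relation.ReflTransGen E v t}, ?_, ?_⟩
    · refine (Set.ncard_image_le (Set.toFinite _)).trans ?_
      have h := Set.ncard_le_ncard_of_injOn (s := {v | Relation.ReflTransGen E v t})
        (t := (Set.univ : Set (Fin k))) (fun v => v.2) (fun _ _ => Set.mem_univ _)
        (fun u hu v hv e => reach_inj hE hv u hu (congrArg Fin.val e)) (Set.toFinite _)
      simpa [Set.ncard_univ] using h
    · rintro (v | a) hx
      · have hv : ¬ Relation.ReflTransGen E v t := fun h => hx ⟨v, h, rfl⟩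
        by_cases hl : (v.2 : ℕ) + 1 < k
        · obtain ⟨w, hw, -⟩ := hE.2.1 v hl
          refine ⟨Sum.inl w, ?_, .base hw⟩
          rintro ⟨w', h, e⟩
          cases Sum.inl.inj e
          exact hv (h.head hw)
        · obtain ⟨a, b⟩ := v
          have hb : b = t.2 := by
            apply Fin.ext
            have := b.2
            simp only at hl
            omega
          subst hb
          refine ⟨_, hx, .loop a ?_⟩
          rintro rfl
          exact hv .refl
      · refine ⟨_, ?_, .pre a⟩
        rintro ⟨w', h, e⟩
        cases Sum.inl.inj e
        have := reach_inj hE hst _ h rfl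
        exact a.2 (congrArg Prod.fst this)
  · rintro ⟨D, hD, hx⟩
    by_contra hst
    have hanc : ∀ v, Relation.ReflTransGen E v t → (Sum.inl v : Vert n k s) ∈ D := by
      intro v hv
      induction hv using Relation.ReflTransGen.head_induction_on with
      | refl =>
        by_contra hn
        obtain ⟨y, hy, hr⟩ := hx _ hn
        generalize hz : (Sum.inl t : Vert n k s) = z at hr
        cases hr with
        | @base v w h =>
          cases Sum.inl.inj hz
          have := hE.1 _ _ h
          have := w.2.2
          omega
        | loop a ha => exact ha (congrArg Prod.fst (Sum.inl.inj hz)).symm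
        | pre a => cases hz
      | @head v w h1 h2 ih =>
        by_contra hn
        have e1 := hE.1 _ _ h1
        have l1 := w.2.2
        obtain ⟨y, hy, hr⟩ := hx _ hn
        generalize hz : (Sum.inl v : Vert n k s) = z at hr
        cases hr with
        | @base v w' h =>
          cases Sum.inl.inj hz
          cases (hE.2.1 _ (by omega)).unique h h1
          exact hy ih
        | loop a ha =>
          cases Sum.inl.inj hz
          simp only at e1
          omega
        | pre a => cases hz
    have hch : ∀ j : Fin k, ∃ v : Fin n × Fin k, v.2 = j ∧ Relation.ReflTransGen E v t := by
      intro j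
      obtain ⟨v, h1, h2⟩ := reach_ex hE ht (k - 1 - j) j (by omega)
      exact ⟨v, Fin.ext h1, h2⟩
    choose f hf1 hf2 using hch
    have ha : (f s.2).1 ≠ s.1 := by
      intro h
      have : f s.2 = s := Prod.ext h (hf1 _)
      exact hst (this ▸ hf2 s.2)
    have hpre : (Sum.inr ⟨(f s.2).1, ha⟩ : Vert n k s) ∈ D := by
      by_contra hn
      obtain ⟨y, hy, hr⟩ := hx _ hn
      generalize hz : (Sum.inr ⟨(f s.2).1, ha⟩ : Vert n k s) = z at hr
      cases hr with
      | base h => cases hz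
      | loop a ha => cases hz
      | pre a =>
        cases Sum.inr.inj hz
        apply hy
        have : ((f s.2).1, s.2) = f s.2 := Prod.ext rfl (hf1 _).symm
        have h2 := hanc _ (hf2 s.2)
        rw [← this] at h2
        exact h2
    let g : Option (Fin k) → D := fun o => match o with
      | none => ⟨_, hpre⟩
      | some j => ⟨_, hanc _ (hf2 j)⟩
    have hg : Function.Injective g := by
      rintro (_ | i) (_ | j) h
      · rfl
      · cases congrArg Subtype.val h
      · cases congrArg Subtype.val h
      · have := Sum.inl.inj (congrArg Subtype.val h)
        rw [← hf1 i, ← hf1 j, this]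
    have := Nat.card_le_card_of_injective g hg
    rw [Nat.card_coe_set_eq] at this
    simp at this
    omega
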